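/- Let E be a pseudo-effect algebra. Then E admits a two-valued state s if and only if there exists a maximal normal ideal I of E such that E = I ∪ I⁻ = I ∪ I~, where I⁻ = {i⁻ : i ∈ I}, I~ = {i~ : i ∈ I}, and I ∩ I⁻ = I ∩ I~ = ∅. -/

import Mathlib

/-- A pseudo-effect algebra (PEA): a structure with a partial addition `add`
(with domain of definition `D`), a zero and a one, satisfying (PE1)-(PE4)
together with the (derivable) neutrality of zero. -/
structure PEA (E : Type) where
  /-- `D a b` means that the partial sum `a + b` is defined. -/
  D : E → E → Prop
  /-- The partial addition (its value is relevant only when `D a b` holds). -/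
  add : E → E → E
  zero : E
  one : E
  /-- (PE1), definedness part. -/
  assoc_defined : ∀ a b c, (D a b ∧ D (add a b) c) ↔ (D b c ∧ D a (add b c))
  /-- (PE1), equality part. -/
  assoc_eq : ∀ a b c, D a b → D (add a b) c → add (add a b) c = add a (add b c)
  /-- (PE2), right complement. -/
  compl_right : ∀ a, ∃! d, D a d ∧ add a d = one
  /-- (PE2), left complement. -/
  compl_left : ∀ a, ∃! e, D e a ∧ add e a = one
  /-- (PE3). -/
  pe3 : ∀ a b, D a b →
    (∃ d, D d a ∧ add d a = add a b) ∧ (∃ e, D b e ∧ add b e = add a b)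
  /-- (PE4). -/
  pe4_right : ∀ a, D a one → a = zero
  pe4_left : ∀ a, D one a → a = zero
  D_zero_right : ∀ a, D a zero
  D_zero_left : ∀ a, D zero a
  add_zero : ∀ a, add a zero = a
  zero_add : ∀ a, add zero a = a

namespace PEA

variable {E : Type} (P : PEA E)

/-- The induced partial order: `a ≤ b` iff `a + c = b` for some `c`. -/
def le (a b : E) : Prop := ∃ c, P.D a c ∧ P.add a c = b

/-- The left complement `a⁻`, the unique element with `a⁻ + a = 1`. -/
noncomputable def lneg (a : E) : E := (P.compl_left a).choose

/-- The right complement `a~`, the unique element with `a + a~ = 1`. -/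
noncomputable def rneg (a : E) : E := (P.compl_right a).choose

/-- `E` is weakly commutative if `a + b` is defined iff `b + a` is defined. -/
def WeaklyCommutative : Prop := ∀ a b, P.D a b ↔ P.D b a

/-- `E` is symmetric if the two complements coincide. -/
def Symmetric : Prop := ∀ a, P.lneg a = P.rneg a

/-- A state on a PEA: a `[0,1]`-valued map, additive on existing sums, sending
`0 ↦ 0` and `1 ↦ 1`. -/
def IsState (s : E → ℝ) : Prop :=
  s P.zero = 0 ∧ s P.one = 1 ∧ (∀ a, 0 ≤ s a ∧ s a ≤ 1) ∧
    ∀ a b, P.D a b → s (P.add a b) = s a + s b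

/-- An `(n+1)`-valued discrete state: a state whose range is `{0, 1/n, …, 1}`. -/
def IsDiscreteState (n : ℕ) (s : E → ℝ) : Prop :=
  P.IsState s ∧ Set.range s = {x : ℝ | ∃ i ≤ n, x = (i : ℝ) / n}

/-- An ideal: a nonempty downward closed subset closed under existing sums. -/
def IsIdeal (I : Set E) : Prop :=
  I.Nonempty ∧ (∀ a i, i ∈ I → P.le a i → a ∈ I) ∧
    ∀ i j, i ∈ I → j ∈ I → P.D i j → P.add i j ∈ I

/-- A normal ideal: `a + i = j + a` implies `i ∈ I ↔ j ∈ I`. -/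
def IsNormalIdeal (I : Set E) : Prop :=
  P.IsIdeal I ∧ ∀ a i j, P.D a i → P.D j a → P.add a i = P.add j a → (i ∈ I ↔ j ∈ I)

/-- A maximal ideal: proper and not properly contained in a proper ideal. -/
def IsMaximalIdeal (I : Set E) : Prop :=
  P.IsIdeal I ∧ P.one ∉ I ∧ ∀ J, P.IsIdeal J → P.one ∉ J → I ⊆ J → I = J

/-- `n`-fold partial multiple of an element. -/
def nmul : ℕ → E → E
  | 0, _ => P.zero
  | k + 1, a => P.add (nmul k a) a

/-- Definedness of the `n`-fold partial multiple. -/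
def nmulD : ℕ → E → Prop
  | 0, _ => True
  | k + 1, a => nmulD k a ∧ P.D (P.nmul k a) a

/-- The set of elements of infinite isotropic index. -/
def Infinit : Set E := {a | ∀ k, P.nmulD k a}

/-- An `n`-decomposition of a PEA. -/
def IsNDecomp (n : ℕ) (F : ℕ → Set E) : Prop :=
  (∀ i, i ≤ n → (F i).Nonempty) ∧
  (∀ i j, i ≤ n → j ≤ n → i ≠ j → F i ∩ F j = ∅) ∧
  ((⋃ i ∈ Set.Iic n, F i) = Set.univ) ∧
  (∀ i, i ≤ n → P.lneg '' F i = F (n - i) ∧ P.rneg '' F i = F (n - i)) ∧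
  (∀ i j, i ≤ n → j ≤ n → ∀ x ∈ F i, ∀ y ∈ F j, P.D x y →
     i + j ≤ n ∧ P.add x y ∈ F (i + j))

/-- An `n`-perfect PEA: an `n`-decomposition with all sums `Eᵢ + Eⱼ`, `i+j < n`,
existing, and whose bottom slice is the unique maximal ideal. -/
def IsNPerfect (n : ℕ) (F : ℕ → Set E) : Prop :=
  P.IsNDecomp n F ∧
  (∀ i j, i + j < n → ∀ x ∈ F i, ∀ y ∈ F j, P.D x y) ∧
  (P.IsMaximalIdeal (F 0) ∧ ∀ J, P.IsMaximalIdeal J → J = F 0)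

end PEA

namespace PEA

theorem lneg_spec' {E : Type} (P : PEA E) (a : E) :
    P.D (P.lneg a) a ∧ P.add (P.lneg a) a = P.one :=
  (P.compl_left a).choose_spec.1

theorem rneg_spec' {E : Type} (P : PEA E) (a : E) :
    P.D a (P.rneg a) ∧ P.add a (P.rneg a) = P.one :=
  (P.compl_right a).choose_spec.1

theorem lneg_rneg' {E : Type} (P : PEA E) (a : E) : P.lneg (P.rneg a) = a :=
  (P.compl_left (P.rneg a)).unique (P.lneg_spec' _) (P.rneg_spec' a)

theorem rneg_lneg' {E : Type} (P : PEA E) (a : E) : P.rneg (P.lneg a) = a :=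
  (P.compl_right (P.lneg a)).unique (P.rneg_spec' _) (P.lneg_spec' a)

end PEA

/-- a PEA admits a two-valued state iff there is a maximal normal
ideal `I` with `E = I ∪ I⁻ = I ∪ I~` and `I ∩ I⁻ = I ∩ I~ = ∅`. -/
theorem stmt5 {E : Type} (P : PEA E) :
    (∃ s : E → ℝ, P.IsState s ∧ Set.range s = {0, 1}) ↔
      ∃ I : Set E, P.IsMaximalIdeal I ∧ P.IsNormalIdeal I ∧
        I ∪ P.lneg '' I = Set.univ ∧ I ∪ P.rneg '' I = Set.univ ∧
        I ∩ P.lneg '' I = ∅ ∧ I ∩ P.rneg '' I = ∅ := by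
  constructor
  · rintro ⟨s, ⟨h0, h1, hb, hadd⟩, hr⟩
    have hv : ∀ x, s x = 0 ∨ s x = 1 := by
      intro x
      have : s x ∈ Set.range s := ⟨x, rfl⟩
      rw [hr] at this
      simpa using this
    have hl : ∀ x, s (P.lneg x) + s x = 1 := by
      intro x
      rw [← hadd _ _ (P.lneg_spec' x).1, (P.lneg_spec' x).2, h1]
    have hrn : ∀ x, s x + s (P.rneg x) = 1 := by
      intro x
      rw [← hadd _ _ (P.rneg_spec' x).1, (P.rneg_spec' x).2, h1]
    have hI : P.IsIdeal {x | s x = 0} := by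
      refine ⟨⟨P.zero, h0⟩, ?_, ?_⟩
      · rintro a i hi ⟨c, hc, rfl⟩
        simp only [Set.mem_setOf_eq] at hi ⊢
        rw [hadd _ _ hc] at hi
        linarith [(hb a).1, (hb c).1]
      · intro i j hi hj hd
        simp only [Set.mem_setOf_eq] at hi hj ⊢
        rw [hadd _ _ hd, hi, hj, add_zero]
    refine ⟨{x | s x = 0}, ⟨hI, ?_, ?_⟩, ⟨hI, ?_⟩, ?_, ?_, ?_, ?_⟩
    · simp [h1]
    · intro J hJ h1J hIJ
      refine Set.Subset.antisymm hIJ ?_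
      intro x hx
      rcases hv x with h | h
      · exact h
      · exfalso
        apply h1J
        have : P.lneg x ∈ J := hIJ (by
          have := hl x
          simp only [Set.mem_setOf_eq]
          linarith)
        rw [← (P.lneg_spec' x).2]
        exact hJ.2.2 _ _ this hx (P.lneg_spec' x).1
    · intro a i j h h' e
      have e' := congrArg s e
      rw [hadd _ _ h, hadd _ _ h'] at e'
      have : s i = s j := by linarith
      simp [this]
    · ext x
      simp only [Set.mem_union, Set.mem_univ, iff_true]
      rcases hv x with h | h
      · exact Or.inl h
      · refine Or.inr ⟨P.rneg x, ?_, P.lneg_rneg' x⟩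
        have := hrn x
        simp only [Set.mem_setOf_eq]
        linarith
    · ext x
      simp only [Set.mem_union, Set.mem_univ, iff_true]
      rcases hv x with h | h
      · exact Or.inl h
      · refine Or.inr ⟨P.lneg x, ?_, P.rneg_lneg' x⟩
        have := hl x
        simp only [Set.mem_setOf_eq]
        linarith
    · rw [Set.eq_empty_iff_forall_notMem]
      rintro _ ⟨hx, i, hi, rfl⟩
      simp only [Set.mem_setOf_eq] at hx hi
      linarith [hl i]
    · rw [Set.eq_empty_iff_forall_notMem]
      rintro _ ⟨hx, i, hi, rfl⟩
      simp only [Set.mem_setOf_eq] at hx hi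
      linarith [hrn i]
  · rintro ⟨I, ⟨⟨⟨i0, hi0⟩, hdown, hsum⟩, h1, -⟩, -, hL, -, -, -⟩
    classical
    have hz : P.zero ∈ I := hdown _ _ hi0 ⟨i0, P.D_zero_left _, P.zero_add _⟩
    refine ⟨fun x => if x ∈ I then 0 else 1, ⟨by simp [hz], by simp [h1], ?_, ?_⟩, ?_⟩
    · intro a
      by_cases h : a ∈ I <;> simp [h]
    · intro a b hd
      have hla : P.add a b ∈ I → a ∈ I := fun h => hdown _ _ h ⟨b, hd, rfl⟩
      have hlb : P.add a b ∈ I → b ∈ I := fun h => hdown _ _ h (P.pe3 a b hd).2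
      by_cases ha : a ∈ I
      · by_cases hb : b ∈ I
        · simp [ha, hb, hsum a b ha hb hd]
        · have : P.add a b ∉ I := fun h => hb (hlb h)
          simp [ha, hb, this]
      · have hab : P.add a b ∉ I := fun h => ha (hla h)
        have hb : b ∈ I := by
          have hmem : a ∈ I ∪ P.lneg '' I := by rw [hL]; trivial
          rcases hmem with h | ⟨i, hi, rfl⟩
          · exact absurd h ha
          · obtain ⟨hD, he⟩ := P.rneg_spec' (P.add (P.lneg i) b)
            obtain ⟨h2, h3⟩ := (P.assoc_defined _ _ _).1 ⟨hd, hD⟩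
            rw [P.assoc_eq _ _ _ hd hD] at he
            exact hdown _ _ hi ⟨_, h2,
              (P.compl_right (P.lneg i)).unique ⟨h3, he⟩ (P.lneg_spec' i)⟩
        simp [ha, hb, hab]
    · ext y
      simp only [Set.mem_range, Set.mem_insert_iff, Set.mem_singleton_iff]
      constructor
      · rintro ⟨x, rfl⟩
        by_cases h : x ∈ I <;> simp [h]
      · rintro (rfl | rfl)
        · exact ⟨P.zero, by simp [hz]⟩
        · exact ⟨P.one, by simp [h1]⟩
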